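/- For every real-valued random variable X with finite variance σ_X² > 0, the non-Gaussianness of X is given by D(P_X ‖ N(E[X], σ_X²)) = (1/2) ∫₀^∞ [σ_X²/(1 + snr · σ_X²) − mmse(snr)] dsnr, where the integrand is nonnegative for every snr ≥ 0, and both sides may equal +∞. -/

import Mathlib

open MeasureTheory ProbabilityTheory Real Filter
open scoped ENNReal NNReal Topology

noncomputable section

open scoped Classical in
/-- Kullback–Leibler divergence `D(μ ‖ ν)` in nats, with values in `[0, ∞]`. -/
def klDiv {α : Type*} [MeasurableSpace α] (μ ν : Measure α) : ℝ≥0∞ :=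
  if μ ≪ ν ∧ Integrable (llr μ ν) μ then ENNReal.ofReal (∫ x, llr μ ν x ∂μ) else ⊤

/-- Mutual information `I(A; B)` in nats: the KL divergence of the joint law of `(A, B)`
from the product of its marginals. -/
def mutualInfo {Ω α β : Type*} [MeasurableSpace Ω] [MeasurableSpace α] [MeasurableSpace β]
    (μ : Measure Ω) (A : Ω → α) (B : Ω → β) : ℝ≥0∞ :=
  klDiv (μ.map fun ω => (A ω, B ω)) ((μ.map A).prod (μ.map B))

/-- Output `Y = √snr · X + N` of the scalar Gaussian channel at signal-to-noise ratio `snr`. -/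
def chOut {Ω : Type*} (X N : Ω → ℝ) (snr : ℝ) : Ω → ℝ := fun ω => Real.sqrt snr * X ω + N ω

/-- Minimum mean-square error `E[(X - E[X | Y])²]` of estimating `X` given `Y`. -/
def mmse {Ω : Type*} [MeasurableSpace Ω] (μ : Measure Ω) (X Y : Ω → ℝ) : ℝ :=
  ∫ ω, (X ω - (μ[X | MeasurableSpace.comap Y inferInstance]) ω) ^ 2 ∂μ

set_option linter.unusedSectionVars false

section helpers

/-- Standard normal density. -/
def stdPhi (u : ℝ) : ℝ := gaussianPDFReal 0 1 u

lemma stdPhi_eq (u : ℝ) : stdPhi u = (√(2 * π))⁻¹ * rexp (-u ^ 2 / 2) := by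
  simp [stdPhi, gaussianPDFReal]

lemma stdPhi_pos (u : ℝ) : 0 < stdPhi u := gaussianPDFReal_pos 0 1 u (by simp)

lemma continuous_stdPhi : Continuous stdPhi := by
  have : stdPhi = fun u => (√(2 * π))⁻¹ * rexp (-u ^ 2 / 2) := funext stdPhi_eq
  rw [this]; fun_prop

@[fun_prop]
lemma measurable_stdPhi : Measurable stdPhi := continuous_stdPhi.measurable

lemma inv_sqrt_two_pi_le_one : (√(2 * π))⁻¹ ≤ 1 := by
  apply inv_le_one_of_one_le₀
  rw [Real.one_le_sqrt]
  have := Real.pi_gt_three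
  linarith

lemma stdPhi_le_one (u : ℝ) : stdPhi u ≤ 1 := by
  rw [stdPhi_eq]
  have h1 : rexp (-u ^ 2 / 2) ≤ 1 := Real.exp_le_one_iff.mpr (by nlinarith [sq_nonneg u])
  have h2 := inv_sqrt_two_pi_le_one
  have h3 := Real.exp_pos (-u ^ 2 / 2)
  nlinarith

lemma abs_mul_stdPhi_le_one (u : ℝ) : |u * stdPhi u| ≤ 1 := by
  rw [abs_mul, abs_of_pos (stdPhi_pos u), stdPhi_eq]
  have h1 : |u| * rexp (-u ^ 2 / 2) ≤ 1 := by
    have h4 : |u| ≤ rexp (u ^ 2 / 2) := by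
      have := Real.add_one_le_exp (u ^ 2 / 2)
      nlinarith [sq_abs u, sq_nonneg (|u| - 1)]
    have h5 : rexp (-u ^ 2 / 2) = (rexp (u ^ 2 / 2))⁻¹ := by
      rw [← Real.exp_neg]; congr 1; ring
    rw [h5, ← div_eq_mul_inv, div_le_one (Real.exp_pos _)]
    exact h4
  have h2 := inv_sqrt_two_pi_le_one
  have h3 : 0 ≤ |u| * rexp (-u ^ 2 / 2) := by positivity
  have h6 : 0 ≤ (√(2 * π))⁻¹ := by positivity
  calc |u| * ((√(2 * π))⁻¹ * rexp (-u ^ 2 / 2)) = (√(2 * π))⁻¹ * (|u| * rexp (-u ^ 2 / 2)) := by ring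
    _ ≤ 1 * 1 := by gcongr
    _ = 1 := by ring

lemma hasDerivAt_stdPhi (u : ℝ) : HasDerivAt stdPhi (-u * stdPhi u) u := by
  have : stdPhi = fun u => (√(2 * π))⁻¹ * rexp (-u ^ 2 / 2) := funext stdPhi_eq
  rw [this]
  have h : HasDerivAt (fun u : ℝ => -u ^ 2 / 2) (-u) u := by
    have h0 : HasDerivAt (fun x : ℝ => x ^ 2) (2 * u) u := by simpa using hasDerivAt_pow 2 u
    exact (h0.neg.div_const 2).congr_deriv (by ring)
  exact ((h.exp).const_mul ((√(2 * π))⁻¹)).congr_deriv (by ring)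

lemma log_stdPhi (u : ℝ) : Real.log (stdPhi u) = Real.log ((√(2 * π))⁻¹) - u ^ 2 / 2 := by
  rw [stdPhi_eq, Real.log_mul (by positivity) (by positivity), Real.log_exp]; ring

/-- `∫ f(x) φ(y - t x) dP(x)`. -/
def num (P : Measure ℝ) (f : ℝ → ℝ) (t y : ℝ) : ℝ := ∫ x, f x * stdPhi (y - t * x) ∂P

lemma integrable_num {P : Measure ℝ} {f : ℝ → ℝ} (hf : Integrable f P) (t y : ℝ) :
    Integrable (fun x => f x * stdPhi (y - t * x)) P := by
  apply hf.mul_bdd (c := 1)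
  · exact (by fun_prop : Measurable fun x => stdPhi (y - t * x)).aestronglyMeasurable
  · refine ae_of_all _ fun x => ?_
    rw [Real.norm_eq_abs, abs_of_pos (stdPhi_pos _)]
    exact stdPhi_le_one _

lemma measurable_num {P : Measure ℝ} [IsProbabilityMeasure P] {f : ℝ → ℝ} (hf : Measurable f) (t : ℝ) :
    Measurable (num P f t) := by
  apply StronglyMeasurable.measurable
  apply StronglyMeasurable.integral_prod_right
  apply Measurable.stronglyMeasurable
  simp only [Function.uncurry_def]
  fun_prop

lemma num_one_pos {P : Measure ℝ} [IsProbabilityMeasure P] (t y : ℝ) :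
    0 < num P (fun _ => 1) t y := by
  unfold num
  rw [integral_pos_iff_support_of_nonneg]
  · have : (Function.support fun x => (1:ℝ) * stdPhi (y - t * x)) = Set.univ := by
      ext x; simp [(stdPhi_pos _).ne']
    rw [this]; simp
  · intro x; simp [(stdPhi_pos _).le]
  · exact integrable_num (integrable_const 1) t y

variable {Ω : Type*} [MeasurableSpace Ω] {μ : Measure Ω} [IsProbabilityMeasure μ] {X N : Ω → ℝ}

lemma map_joint (hX : Measurable X) (hN : Measurable N) (hXN : IndepFun X N μ)
    (hN_law : μ.map N = gaussianReal 0 1) (t : ℝ) :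
    μ.map (fun ω => (X ω, t * X ω + N ω)) =
      ((μ.map X).prod volume).withDensity (fun z => ENNReal.ofReal (stdPhi (z.2 - t * z.1))) := by
  have : IsProbabilityMeasure (μ.map X) := Measure.isProbabilityMeasure_map hX.aemeasurable
  have h1 := (indepFun_iff_map_prod_eq_prod_map_map hX.aemeasurable hN.aemeasurable).1 hXN
  have h2 : μ.map (fun ω => (X ω, t * X ω + N ω)) =
      ((μ.map X).prod (gaussianReal 0 1)).map (fun z => (z.1, t * z.1 + z.2)) := by
    rw [← hN_law, ← h1, Measure.map_map (by fun_prop) (by fun_prop)]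
    rfl
  rw [h2]
  apply Measure.ext_of_lintegral
  intro h hh
  rw [lintegral_map hh (by fun_prop), lintegral_prod _ (by fun_prop),
    lintegral_withDensity_eq_lintegral_mul _ (by fun_prop) hh, lintegral_prod _ (by fun_prop)]
  refine lintegral_congr fun x => ?_
  rw [gaussianReal_of_var_ne_zero _ (by simp),
    lintegral_withDensity_eq_lintegral_mul _ (by fun_prop) (by fun_prop)]
  simp only [Pi.mul_apply]
  rw [← lintegral_sub_right_eq_self _ (t * x)]
  refine lintegral_congr fun y => ?_
  simp [gaussianPDF, stdPhi]

lemma integral_joint (hX : Measurable X) (hN : Measurable N) (hXN : IndepFun X N μ)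
    (hN_law : μ.map N = gaussianReal 0 1) (t : ℝ) {h : ℝ × ℝ → ℝ} (hh : Measurable h) :
    ∫ ω, h (X ω, t * X ω + N ω) ∂μ =
      ∫ z, h z * stdPhi (z.2 - t * z.1) ∂((μ.map X).prod volume) := by
  have h1 := map_joint hX hN hXN hN_law t
  rw [← integral_map (φ := fun ω => (X ω, t * X ω + N ω)) (by fun_prop) hh.aestronglyMeasurable, h1,
    integral_withDensity_eq_integral_toReal_smul (by fun_prop) (by simp)]
  refine integral_congr_ae (ae_of_all _ fun z => ?_)
  simp [ENNReal.toReal_ofReal (stdPhi_pos _).le, mul_comm]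

lemma integrable_joint (hX : Measurable X) (hN : Measurable N) (hXN : IndepFun X N μ)
    (hN_law : μ.map N = gaussianReal 0 1) (t : ℝ) {h : ℝ × ℝ → ℝ} (hh : Measurable h) :
    Integrable (fun ω => h (X ω, t * X ω + N ω)) μ ↔
      Integrable (fun z => h z * stdPhi (z.2 - t * z.1)) ((μ.map X).prod volume) := by
  have h1 := map_joint hX hN hXN hN_law t
  have h2 : Integrable (fun ω => h (X ω, t * X ω + N ω)) μ ↔
      Integrable h (μ.map (fun ω => (X ω, t * X ω + N ω))) :=
    (integrable_map_measure hh.aestronglyMeasurable (by fun_prop)).symm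
  rw [h2, h1, integrable_withDensity_iff_integrable_smul' (by fun_prop) (by simp)]
  refine integrable_congr (ae_of_all _ fun z => ?_)
  simp [ENNReal.toReal_ofReal (stdPhi_pos _).le, mul_comm]

/-- law of the output has density `num 1`. -/
lemma map_out (hX : Measurable X) (hN : Measurable N) (hXN : IndepFun X N μ)
    (hN_law : μ.map N = gaussianReal 0 1) (t : ℝ) :
    μ.map (fun ω => t * X ω + N ω) =
      volume.withDensity (fun y => ENNReal.ofReal (num (μ.map X) (fun _ => 1) t y)) := by
  have : IsProbabilityMeasure (μ.map X) := Measure.isProbabilityMeasure_map hX.aemeasurable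
  have h1 := map_joint hX hN hXN hN_law t
  have h2 : μ.map (fun ω => t * X ω + N ω) =
      (μ.map (fun ω => (X ω, t * X ω + N ω))).map Prod.snd := by
    rw [Measure.map_map (by fun_prop) (by fun_prop)]; rfl
  rw [h2, h1]
  apply Measure.ext_of_lintegral
  intro h hh
  have hm := measurable_num (P := μ.map X) (f := fun _ => 1) (by fun_prop) t
  rw [lintegral_map hh (by fun_prop),
    lintegral_withDensity_eq_lintegral_mul _ (by fun_prop) (by fun_prop),
    lintegral_prod_symm' _ (by fun_prop),
    lintegral_withDensity_eq_lintegral_mul _ (by fun_prop) hh]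
  refine lintegral_congr fun y => ?_
  simp only [Pi.mul_apply]
  rw [lintegral_mul_const _ (by fun_prop)]
  congr 1
  unfold num
  rw [ofReal_integral_eq_lintegral_ofReal (integrable_num (integrable_const 1) t y)]
  · simp
  · exact ae_of_all _ fun x => by simp [(stdPhi_pos _).le]

lemma integrable_out (hX : Measurable X) (hN : Measurable N) (hXN : IndepFun X N μ)
    (hN_law : μ.map N = gaussianReal 0 1) (t : ℝ) {h : ℝ → ℝ} (hh : Measurable h) :
    Integrable (fun ω => h (t * X ω + N ω)) μ ↔
      Integrable (fun y => h y * num (μ.map X) (fun _ => 1) t y) volume := by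
  have : IsProbabilityMeasure (μ.map X) := Measure.isProbabilityMeasure_map hX.aemeasurable
  have h1 := map_out hX hN hXN hN_law t
  have hm := measurable_num (P := μ.map X) (f := fun _ => 1) (by fun_prop) t
  have h2 : Integrable (fun ω => h (t * X ω + N ω)) μ ↔
      Integrable h (μ.map (fun ω => (t * X ω + N ω))) :=
    (integrable_map_measure hh.aestronglyMeasurable (by fun_prop)).symm
  rw [h2, h1, integrable_withDensity_iff_integrable_smul' (by fun_prop) (by simp)]
  refine integrable_congr (ae_of_all _ fun z => ?_)
  simp [ENNReal.toReal_ofReal (num_one_pos _ _).le, mul_comm]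

lemma integral_out (hX : Measurable X) (hN : Measurable N) (hXN : IndepFun X N μ)
    (hN_law : μ.map N = gaussianReal 0 1) (t : ℝ) {h : ℝ → ℝ} (hh : Measurable h) :
    ∫ ω, h (t * X ω + N ω) ∂μ = ∫ y, h y * num (μ.map X) (fun _ => 1) t y := by
  have : IsProbabilityMeasure (μ.map X) := Measure.isProbabilityMeasure_map hX.aemeasurable
  have h1 := map_out hX hN hXN hN_law t
  have hm := measurable_num (P := μ.map X) (f := fun _ => 1) (by fun_prop) t
  rw [← integral_map (φ := fun ω => (t * X ω + N ω)) (by fun_prop) hh.aestronglyMeasurable, h1,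
    integral_withDensity_eq_integral_toReal_smul (by fun_prop) (by simp)]
  refine integral_congr_ae (ae_of_all _ fun z => ?_)
  simp [ENNReal.toReal_ofReal (num_one_pos _ _).le, mul_comm]

/-- Posterior mean of `f`. -/
def post (P : Measure ℝ) (f : ℝ → ℝ) (t y : ℝ) : ℝ := num P f t y / num P (fun _ => 1) t y

lemma measurable_post {P : Measure ℝ} [IsProbabilityMeasure P] {f : ℝ → ℝ} (hf : Measurable f) (t : ℝ) :
    Measurable (post P f t) :=
  (measurable_num hf t).div (measurable_num (by fun_prop) t)

lemma post_mul {P : Measure ℝ} [IsProbabilityMeasure P] (f : ℝ → ℝ) (t y : ℝ) :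
    post P f t y * num P (fun _ => 1) t y = num P f t y :=
  div_mul_cancel₀ _ (num_one_pos t y).ne'

lemma condExp_post (hX : Measurable X) (hN : Measurable N) (hXN : IndepFun X N μ)
    (hN_law : μ.map N = gaussianReal 0 1) (t : ℝ) {f : ℝ → ℝ} (hf : Measurable f)
    (hfi : Integrable (fun ω => f (X ω)) μ) :
    (fun ω => post (μ.map X) f t (t * X ω + N ω)) =ᵐ[μ]
      μ[fun ω => f (X ω) | MeasurableSpace.comap (fun ω => t * X ω + N ω) inferInstance] := by
  have : IsProbabilityMeasure (μ.map X) := Measure.isProbabilityMeasure_map hX.aemeasurable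
  have hY : Measurable (fun ω => t * X ω + N ω) := by fun_prop
  have hm := measurable_num (P := μ.map X) (f := fun _ => 1) (by fun_prop) t
  have hj : Integrable (fun z : ℝ × ℝ => f z.1 * stdPhi (z.2 - t * z.1)) ((μ.map X).prod volume) :=
    (integrable_joint hX hN hXN hN_law t (h := fun z => f z.1) (by fun_prop)).1 hfi
  have hpi : Integrable (fun ω => post (μ.map X) f t (t * X ω + N ω)) μ := by
    rw [integrable_out hX hN hXN hN_law t (measurable_post hf t)]
    simp only [post_mul]
    exact hj.integral_prod_right
  refine ae_eq_condExp_of_forall_setIntegral_eq hY.comap_le hfi ?_ ?_ ?_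
  · intro s hs _
    exact hpi.integrableOn
  · rintro s ⟨B, hB, rfl⟩ _
    have hBm : MeasurableSet ((fun ω => t * X ω + N ω) ⁻¹' B) := hY hB
    rw [← integral_indicator hBm, ← integral_indicator hBm]
    have e1 := integral_out hX hN hXN hN_law t
      (h := B.indicator (post (μ.map X) f t)) ((measurable_post hf t).indicator hB)
    have e2 := integral_joint hX hN hXN hN_law t
      (h := fun z => B.indicator (fun _ => f z.1) z.2)
      (by
        have : (fun z : ℝ × ℝ => B.indicator (fun _ => f z.1) z.2)
          = (Prod.snd ⁻¹' B).indicator (fun z => f z.1) := by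
            ext z; rfl
        rw [this]
        exact (by fun_prop : Measurable fun z : ℝ × ℝ => f z.1).indicator (measurable_snd hB))
    have e3 : ∫ z, B.indicator (fun _ => f z.1) z.2 * stdPhi (z.2 - t * z.1) ∂((μ.map X).prod volume)
        = ∫ y, B.indicator (post (μ.map X) f t) y * num (μ.map X) (fun _ => 1) t y := by
      rw [integral_prod_symm]
      · refine integral_congr_ae (ae_of_all _ fun y => ?_)
        by_cases hy : y ∈ B
        · simp only [Set.indicator_of_mem hy, post_mul]; rfl
        · simp [Set.indicator_of_notMem hy]
      · have : (fun z : ℝ × ℝ => B.indicator (fun _ => f z.1) z.2 * stdPhi (z.2 - t * z.1))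
          = (Prod.snd ⁻¹' B).indicator (fun z => f z.1 * stdPhi (z.2 - t * z.1)) := by
            ext z; by_cases hz : z.2 ∈ B <;> simp [Set.indicator, hz]
        rw [this]
        exact hj.indicator (measurable_snd hB)
    calc _ = ∫ ω, B.indicator (post (μ.map X) f t) (t * X ω + N ω) ∂μ := rfl
      _ = ∫ ω, B.indicator (fun _ => f (X ω)) (t * X ω + N ω) ∂μ := by
          rw [e1, ← e3, ← e2]
      _ = _ := rfl
  · exact ((measurable_post hf t).comp (comap_measurable _)).aestronglyMeasurable

/-- derivative of the output density along `y = t x + n`. -/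
def dnum (P : Measure ℝ) (t x n : ℝ) : ℝ :=
  ∫ x', (-((t * (x - x') + n) * stdPhi (t * (x - x') + n))) * (x - x') ∂P

lemma dnum_bound (t x n x' : ℝ) :
    ‖(-((t * (x - x') + n) * stdPhi (t * (x - x') + n))) * (x - x')‖ ≤ |x| + |x'| := by
  rw [Real.norm_eq_abs, abs_mul, abs_neg]
  have h1 := abs_mul_stdPhi_le_one (t * (x - x') + n)
  have h2 := abs_sub x x'
  have h3 := abs_nonneg (x - x')
  calc _ ≤ 1 * |x - x'| := by gcongr
    _ ≤ _ := by rw [one_mul]; exact h2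

lemma hasDerivAt_num {P : Measure ℝ} [IsProbabilityMeasure P] (hP : Integrable (fun x => x) P)
    (t x n : ℝ) :
    HasDerivAt (fun t => num P (fun _ => 1) t (t * x + n)) (dnum P t x n) t := by
  have key := hasDerivAt_integral_of_dominated_loc_of_deriv_le (μ := P) (s := Set.univ) (x₀ := t)
    (F := fun t x' => stdPhi (t * (x - x') + n))
    (F' := fun t x' => (-((t * (x - x') + n) * stdPhi (t * (x - x') + n))) * (x - x'))
    (bound := fun x' => |x| + |x'|) Filter.univ_mem
    (Filter.Eventually.of_forall fun s => (by fun_prop : Measurable fun x' => stdPhi (s * (x - x') + n)).aestronglyMeasurable)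
    ?_ (by fun_prop) (ae_of_all _ fun x' s _ => dnum_bound s x n x') ?_
    (ae_of_all _ fun x' s _ => ?_)
  · have := key.2
    unfold dnum num
    have e : ∀ s x' : ℝ, (1:ℝ) * stdPhi (s * x + n - s * x') = stdPhi (s * (x - x') + n) := by
      intro s x'
      rw [one_mul]; congr 1; ring
    simp only [e]
    exact this
  · refine Integrable.of_bound (C := 1) (by fun_prop : Measurable fun x' => stdPhi (t * (x - x') + n)).aestronglyMeasurable (ae_of_all _ fun x' => ?_)
    rw [Real.norm_eq_abs, abs_of_pos (stdPhi_pos _)]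
    exact stdPhi_le_one _
  · exact (integrable_const _).add hP.abs
  · have h1 : HasDerivAt (fun s : ℝ => s * (x - x') + n) (x - x') s := by
      simpa using ((hasDerivAt_id s).mul_const (x - x')).add_const n
    have := (hasDerivAt_stdPhi (s * (x - x') + n)).comp s h1
    exact this.congr_deriv (by ring)

lemma continuous_dnum {P : Measure ℝ} [IsProbabilityMeasure P] (hP : Integrable (fun x => x) P)
    (x n : ℝ) : Continuous (fun t => dnum P t x n) := by
  unfold dnum
  have := continuous_stdPhi
  refine continuous_of_dominated (bound := fun x' => |x| + |x'|) ?_ ?_ ?_ ?_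
  · intro t; fun_prop
  · intro t; exact ae_of_all _ fun x' => dnum_bound t x n x'
  · exact (integrable_const _).add hP.abs
  · refine ae_of_all _ fun x' => ?_; fun_prop

/-- logarithmic derivative. -/
def lder (P : Measure ℝ) (t x n : ℝ) : ℝ := dnum P t x n / num P (fun _ => 1) t (t * x + n)

lemma num_zero {P : Measure ℝ} [IsProbabilityMeasure P] (y : ℝ) :
    num P (fun _ => 1) 0 y = stdPhi y := by
  simp [num]

lemma ftc_lder {P : Measure ℝ} [IsProbabilityMeasure P] (hP : Integrable (fun x => x) P)
    (x n T : ℝ) :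
    ∫ t in (0:ℝ)..T, lder P t x n =
      Real.log (num P (fun _ => 1) T (T * x + n)) - Real.log (stdPhi n) := by
  have hd : ∀ t, HasDerivAt (fun t => Real.log (num P (fun _ => 1) t (t * x + n))) (lder P t x n) t :=
    fun t => (hasDerivAt_num hP t x n).log (num_one_pos _ _).ne'
  have hc : Continuous (fun t => num P (fun _ => 1) t (t * x + n)) :=
    continuous_iff_continuousAt.2 fun t => (hasDerivAt_num hP t x n).continuousAt
  have hl : Continuous (fun t => lder P t x n) :=
    (continuous_dnum hP x n).div hc fun t => (num_one_pos _ _).ne'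
  rw [intervalIntegral.integral_eq_sub_of_hasDerivAt (fun t _ => hd t) (hl.intervalIntegrable _ _)]
  simp [num_zero]

lemma lder_eq {P : Measure ℝ} [IsProbabilityMeasure P] (hP : Integrable (fun x => x) P)
    (hP2 : Integrable (fun x => x ^ 2) P) (t x n : ℝ) :
    lder P t x n = -(x * (t * x + n) - t * (x * post P (fun x => x) t (t * x + n))
      - (t * x + n) * post P (fun x => x) t (t * x + n)
      + t * post P (fun x => x ^ 2) t (t * x + n)) := by
  have hp := num_one_pos (P := P) t (t * x + n)
  have h0 := integrable_num (integrable_const (1:ℝ) (μ := P)) t (t * x + n)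
  have h1 := integrable_num hP t (t * x + n)
  have h2 := integrable_num hP2 t (t * x + n)
  have : dnum P t x n = -(x * (t * x + n)) * num P (fun _ => 1) t (t * x + n)
      + (t * x + (t * x + n)) * num P (fun x => x) t (t * x + n)
      + (-t) * num P (fun x => x ^ 2) t (t * x + n) := by
    unfold num dnum
    rw [← integral_const_mul, ← integral_const_mul, ← integral_const_mul,
      ← integral_add (h0.const_mul _) (h1.const_mul _)]
    refine Eq.trans ?_ (integral_add ((h0.const_mul _).add (h1.const_mul _)) (h2.const_mul _))
    refine integral_congr_ae (ae_of_all _ fun x' => ?_)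
    have e : t * x + n - t * x' = t * (x - x') + n := by ring
    simp only [e]
    ring
  unfold lder post
  rw [this]
  generalize num P (fun _ => 1) t (t * x + n) = p at *
  have := hp.ne'
  field_simp
  ring

lemma measurable_num_joint {P : Measure ℝ} [IsProbabilityMeasure P] :
    Measurable (fun z : ℝ × ℝ × ℝ => num P (fun _ => 1) z.1 (z.1 * z.2.1 + z.2.2)) := by
  apply StronglyMeasurable.measurable
  apply StronglyMeasurable.integral_prod_right
  apply Measurable.stronglyMeasurable
  simp only [Function.uncurry_def]
  fun_prop

lemma measurable_lder {P : Measure ℝ} [IsProbabilityMeasure P] :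
    Measurable (fun z : ℝ × ℝ × ℝ => lder P z.1 z.2.1 z.2.2) := by
  refine Measurable.div ?_ measurable_num_joint
  apply StronglyMeasurable.measurable
  apply StronglyMeasurable.integral_prod_right
  apply Measurable.stronglyMeasurable
  simp only [Function.uncurry_def]
  fun_prop

/-- pull-out property -/
lemma integral_condExp_mul {Ω : Type*} {m m0 : MeasurableSpace Ω} {μ : Measure Ω}
    [IsProbabilityMeasure μ] (hm : m ≤ m0) {W Z : Ω → ℝ} (hW : MemLp W 2 μ) (hZ : MemLp Z 2 μ) (hZm : StronglyMeasurable[m] Z) :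
    ∫ ω, W ω * Z ω ∂μ = ∫ ω, (μ[W | m]) ω * Z ω ∂μ := by
  have h := condExp_mul_of_stronglyMeasurable_right (m := m) hZm (hW.integrable_mul hZ)
    (hW.integrable (by norm_num))
  have h2 := integral_condExp (μ := μ) hm (f := W * Z)
  rw [integral_congr_ae h] at h2
  exact h2.symm

lemma mmse_general {Ω : Type*} {m m0 : MeasurableSpace Ω} {μ : Measure Ω}
    [IsProbabilityMeasure μ] (hm : m ≤ m0) {W : Ω → ℝ} (hW : MemLp W 2 μ) :
    ∫ ω, (W ω - (μ[W | m]) ω) ^ 2 ∂μ = ∫ ω, W ω ^ 2 ∂μ - ∫ ω, (μ[W | m]) ω ^ 2 ∂μ := by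
  have hc : MemLp (μ[W | m]) 2 μ := hW.condExp (by norm_num)
  have h := integral_condExp_mul hm hW hc stronglyMeasurable_condExp
  have i1 : Integrable (fun ω => W ω ^ 2) μ := hW.integrable_sq
  have i2 : Integrable (fun ω => (μ[W | m]) ω ^ 2) μ := hc.integrable_sq
  have i3 : Integrable (fun ω => W ω * (μ[W | m]) ω) μ := hW.integrable_mul hc
  have e : ∀ ω, (W ω - (μ[W | m]) ω) ^ 2 =
      W ω ^ 2 - 2 * (W ω * (μ[W | m]) ω) + (μ[W | m]) ω ^ 2 := fun ω => by ring
  simp_rw [e]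
  have i4 : Integrable (fun ω => W ω ^ 2 - 2 * (W ω * (μ[W | m]) ω)) μ := i1.sub (i3.const_mul 2)
  rw [integral_add i4 i2, integral_sub i1 (i3.const_mul 2),
    integral_const_mul, h]
  simp_rw [← pow_two]
  ring

lemma mmse_le_general {Ω : Type*} {m m0 : MeasurableSpace Ω} {μ : Measure Ω}
    [IsProbabilityMeasure μ] (hm : m ≤ m0) {W Z : Ω → ℝ} (hW : MemLp W 2 μ) (hZ : MemLp Z 2 μ) (hZm : StronglyMeasurable[m] Z) :
    ∫ ω, (W ω - (μ[W | m]) ω) ^ 2 ∂μ ≤ ∫ ω, (W ω - Z ω) ^ 2 ∂μ := by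
  have h := mmse_general hm (hW.sub hZ)
  have e : μ[W - Z | m] =ᵐ[μ] μ[W | m] - Z := by
    have h1 := condExp_sub (μ := μ) (hW.integrable (by norm_num)) (hZ.integrable (by norm_num)) m
    rwa [condExp_of_stronglyMeasurable hm hZm (hZ.integrable (by norm_num))] at h1
  have e2 : ∫ ω, ((W - Z) ω - (μ[W - Z | m]) ω) ^ 2 ∂μ = ∫ ω, (W ω - (μ[W | m]) ω) ^ 2 ∂μ := by
    apply integral_congr_ae
    filter_upwards [e] with ω hω
    simp [hω]
  rw [e2] at h
  rw [h]
  have : 0 ≤ ∫ ω, (μ[W - Z | m]) ω ^ 2 ∂μ := integral_nonneg fun ω => sq_nonneg _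
  simp only [Pi.sub_apply]
  linarith

lemma memLp_N (hN : Measurable N) (hN_law : μ.map N = gaussianReal 0 1) : MemLp N 2 μ := by
  have h : MemLp id 2 (μ.map N) := by
    rw [hN_law]; exact memLp_id_gaussianReal 2
  exact (memLp_map_measure_iff (by fun_prop) hN.aemeasurable).1 h

lemma integral_N (hN : Measurable N) (hN_law : μ.map N = gaussianReal 0 1) : ∫ ω, N ω ∂μ = 0 := by
  have h : ∫ x, x ∂(μ.map N) = 0 := by
    rw [hN_law]; simp
  rwa [integral_map hN.aemeasurable (by fun_prop)] at h

lemma integral_N_sq (hN : Measurable N) (hN_law : μ.map N = gaussianReal 0 1) :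
    ∫ ω, N ω ^ 2 ∂μ = 1 := by
  have : IsProbabilityMeasure (μ.map N) := Measure.isProbabilityMeasure_map hN.aemeasurable
  have h : Var[id; μ.map N] = 1 := by
    rw [hN_law, variance_id_gaussianReal]; simp
  rw [variance_eq_sub (by rw [hN_law]; exact memLp_id_gaussianReal 2)] at h
  have h0 : ∫ x, x ∂(μ.map N) = 0 := by
    rw [hN_law]; simp
  have h1 : ∫ x, x ^ 2 ∂(μ.map N) = 1 := by
    simpa [h0] using h
  rwa [integral_map hN.aemeasurable (by fun_prop)] at h1

lemma memLp_X (hX : Measurable X) (hX2 : Integrable (fun ω => X ω ^ 2) μ) : MemLp X 2 μ :=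
  (memLp_two_iff_integrable_sq hX.aestronglyMeasurable).2 hX2

lemma integral_XN (hX : Measurable X) (hN : Measurable N) (hXN : IndepFun X N μ)
    (hN_law : μ.map N = gaussianReal 0 1) : ∫ ω, X ω * N ω ∂μ = 0 := by
  have := hXN.integral_fun_mul_eq_mul_integral hX.aestronglyMeasurable hN.aestronglyMeasurable
  rw [this, integral_N hN hN_law, mul_zero]

/-- the mmse at amplitude `t`. -/
def mm (μ : Measure Ω) (X N : Ω → ℝ) (t : ℝ) : ℝ := mmse μ X (fun ω => t * X ω + N ω)

lemma memLp_Y (hX : Measurable X) (hN : Measurable N)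
    (hN_law : μ.map N = gaussianReal 0 1) (hX2 : Integrable (fun ω => X ω ^ 2) μ) (t : ℝ) :
    MemLp (fun ω => t * X ω + N ω) 2 μ :=
  ((memLp_X hX hX2).const_mul t).add (memLp_N hN hN_law)

lemma integral_Y_sq (hX : Measurable X) (hN : Measurable N) (hXN : IndepFun X N μ)
    (hN_law : μ.map N = gaussianReal 0 1) (hX2 : Integrable (fun ω => X ω ^ 2) μ) (t : ℝ) :
    ∫ ω, (t * X ω + N ω) ^ 2 ∂μ = t ^ 2 * ∫ ω, X ω ^ 2 ∂μ + 1 := by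
  have hXL := memLp_X hX hX2
  have hNL := memLp_N hN hN_law
  have i1 : Integrable (fun ω => t ^ 2 * X ω ^ 2) μ := hX2.const_mul _
  have i2 : Integrable (fun ω => 2 * t * (X ω * N ω)) μ := (hXL.integrable_mul hNL).const_mul _
  have i3 : Integrable (fun ω => N ω ^ 2) μ := hNL.integrable_sq
  have i4 : Integrable (fun ω => t ^ 2 * X ω ^ 2 + 2 * t * (X ω * N ω)) μ := i1.add i2
  have e : ∀ ω, (t * X ω + N ω) ^ 2 = t ^ 2 * X ω ^ 2 + 2 * t * (X ω * N ω) + N ω ^ 2 :=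
    fun ω => by ring
  simp_rw [e]
  rw [integral_add i4 i3, integral_add i1 i2, integral_const_mul, integral_const_mul,
    integral_XN hX hN hXN hN_law, integral_N_sq hN hN_law]
  ring

lemma integral_XY (hX : Measurable X) (hN : Measurable N) (hXN : IndepFun X N μ)
    (hN_law : μ.map N = gaussianReal 0 1) (hX2 : Integrable (fun ω => X ω ^ 2) μ) (t : ℝ) :
    ∫ ω, X ω * (t * X ω + N ω) ∂μ = t * ∫ ω, X ω ^ 2 ∂μ := by
  have hXL := memLp_X hX hX2
  have hNL := memLp_N hN hN_law
  have i1 : Integrable (fun ω => t * X ω ^ 2) μ := hX2.const_mul _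
  have i2 : Integrable (fun ω => X ω * N ω) μ := hXL.integrable_mul hNL
  have e : ∀ ω, X ω * (t * X ω + N ω) = t * X ω ^ 2 + (X ω * N ω) :=
    fun ω => by ring
  simp_rw [e]
  rw [integral_add i1 i2, integral_const_mul, integral_XN hX hN hXN hN_law]
  ring

lemma lder_facts (hX : Measurable X) (hN : Measurable N) (hXN : IndepFun X N μ)
    (hN_law : μ.map N = gaussianReal 0 1) (hX2 : Integrable (fun ω => X ω ^ 2) μ) (t : ℝ)
    (ht : 0 ≤ t) :
    Integrable (fun ω => lder (μ.map X) t (X ω) (N ω)) μ ∧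
    ∫ ω, lder (μ.map X) t (X ω) (N ω) ∂μ = -(t * mm μ X N t) ∧
    ∫ ω, ‖lder (μ.map X) t (X ω) (N ω)‖ ∂μ ≤
      (t ^ 2 + 2 * t + 1) * ∫ ω, X ω ^ 2 ∂μ + 1 := by
  have : IsProbabilityMeasure (μ.map X) := Measure.isProbabilityMeasure_map hX.aemeasurable
  set P := μ.map X with hPdef
  set Y : Ω → ℝ := fun ω => t * X ω + N ω with hYdef
  have hY : Measurable Y := by fun_prop
  have hXL := memLp_X hX hX2
  have hNL := memLp_N hN hN_law
  have hYL : MemLp Y 2 μ := memLp_Y hX hN hN_law hX2 t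
  have hXi : Integrable X μ := hXL.integrable (by norm_num)
  have hPi : Integrable (fun x => x) P :=
    (integrable_map_measure (by fun_prop) hX.aemeasurable).2 hXi
  have hPi2 : Integrable (fun x => x ^ 2) P :=
    (integrable_map_measure (by fun_prop) hX.aemeasurable).2 hX2
  have hm := hY.comap_le
  set e : Ω → ℝ := fun ω => post P (fun x => x) t (Y ω) with hedef
  set R : Ω → ℝ := fun ω => post P (fun x => x ^ 2) t (Y ω) with hRdef
  have he : e =ᵐ[μ] μ[X | MeasurableSpace.comap Y inferInstance] := condExp_post hX hN hXN hN_law t (f := fun x => x) (by fun_prop) hXi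
  have hR : R =ᵐ[μ] μ[fun ω => X ω ^ 2 | MeasurableSpace.comap Y inferInstance] :=
    condExp_post hX hN hXN hN_law t (f := fun x => x ^ 2) (by fun_prop) hX2
  have hcL : MemLp (μ[X | MeasurableSpace.comap Y inferInstance]) 2 μ := hXL.condExp (by norm_num)
  have heL : MemLp e 2 μ := hcL.ae_eq he.symm
  have hRi : Integrable R μ := (integrable_congr hR).2 integrable_condExp
  have hRint : ∫ ω, R ω ∂μ = ∫ ω, X ω ^ 2 ∂μ := by
    rw [integral_congr_ae hR, integral_condExp hm]
  have hR0 : ∀ ω, 0 ≤ R ω := fun ω => by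
    refine div_nonneg (integral_nonneg fun x => ?_) (num_one_pos _ _).le
    exact mul_nonneg (sq_nonneg _) (stdPhi_pos _).le
  have heq : ∀ ω, lder P t (X ω) (N ω) =
      -(X ω * Y ω - t * (X ω * e ω) - Y ω * e ω + t * R ω) := fun ω =>
    lder_eq hPi hPi2 t (X ω) (N ω)
  have iXY : Integrable (fun ω => X ω * Y ω) μ := hXL.integrable_mul hYL
  have iXe : Integrable (fun ω => X ω * e ω) μ := hXL.integrable_mul heL
  have iYe : Integrable (fun ω => Y ω * e ω) μ := hYL.integrable_mul heL
  have ie2 : Integrable (fun ω => e ω ^ 2) μ := heL.integrable_sq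
  have iY2 : Integrable (fun ω => Y ω ^ 2) μ := hYL.integrable_sq
  have i1 : Integrable (fun ω => X ω * Y ω - t * (X ω * e ω)) μ := iXY.sub (iXe.const_mul t)
  have i2 : Integrable (fun ω => X ω * Y ω - t * (X ω * e ω) - Y ω * e ω) μ := i1.sub iYe
  have i3 : Integrable (fun ω => X ω * Y ω - t * (X ω * e ω) - Y ω * e ω + t * R ω) μ :=
    i2.add (hRi.const_mul t)
  have vXe : ∫ ω, X ω * e ω ∂μ = ∫ ω, e ω ^ 2 ∂μ := by
    have h1 := integral_condExp_mul hm hXL hcL stronglyMeasurable_condExp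
    have h2 : ∫ ω, X ω * e ω ∂μ = ∫ ω, X ω * (μ[X | MeasurableSpace.comap Y inferInstance]) ω ∂μ := by
      apply integral_congr_ae
      filter_upwards [he] with ω hω
      rw [hω]
    have h3 : ∫ ω, e ω ^ 2 ∂μ = ∫ ω, (μ[X | MeasurableSpace.comap Y inferInstance]) ω * (μ[X | MeasurableSpace.comap Y inferInstance]) ω ∂μ := by
      apply integral_congr_ae
      filter_upwards [he] with ω hω
      rw [hω, pow_two]
    rw [h2, h1, h3]
  have vYe : ∫ ω, Y ω * e ω ∂μ = t * ∫ ω, X ω ^ 2 ∂μ := by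
    have h1 := integral_condExp_mul hm hXL hYL (comap_measurable Y).stronglyMeasurable
    rw [integral_XY hX hN hXN hN_law hX2 t] at h1
    rw [h1]
    apply integral_congr_ae
    filter_upwards [he] with ω hω
    rw [hω, mul_comm]
  have vmm : mm μ X N t = ∫ ω, X ω ^ 2 ∂μ - ∫ ω, e ω ^ 2 ∂μ := by
    have h1 := mmse_general hm hXL
    have h3 : ∫ ω, e ω ^ 2 ∂μ = ∫ ω, (μ[X | MeasurableSpace.comap Y inferInstance]) ω ^ 2 ∂μ := by
      apply integral_congr_ae
      filter_upwards [he] with ω hω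
      rw [hω]
    rw [h3, ← h1]; rfl
  have hmm0 : 0 ≤ mm μ X N t := integral_nonneg fun ω => sq_nonneg _
  have vXY := integral_XY hX hN hXN hN_law hX2 t
  have vY2 := integral_Y_sq hX hN hXN hN_law hX2 t
  simp_rw [heq]
  refine ⟨i3.neg, ?_, ?_⟩
  · rw [integral_neg, integral_add i2 (hRi.const_mul t), integral_sub i1 iYe,
      integral_sub iXY (iXe.const_mul t), integral_const_mul, integral_const_mul, vXe, vYe, vXY,
      hRint, vmm]
    ring
  · have j1 : Integrable (fun ω => (1 + t) / 2 * X ω ^ 2 + Y ω ^ 2) μ :=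
      (hX2.const_mul _).add iY2
    have j2 : Integrable (fun ω => (1 + t) / 2 * X ω ^ 2 + Y ω ^ 2 + (1 + t) / 2 * e ω ^ 2) μ :=
      j1.add (ie2.const_mul _)
    have j3 : Integrable (fun ω => (1 + t) / 2 * X ω ^ 2 + Y ω ^ 2 + (1 + t) / 2 * e ω ^ 2
        + t * R ω) μ := j2.add (hRi.const_mul _)
    have hle : ∫ ω, ‖-(X ω * Y ω - t * (X ω * e ω) - Y ω * e ω + t * R ω)‖ ∂μ ≤
        ∫ ω, ((1 + t) / 2 * X ω ^ 2 + Y ω ^ 2 + (1 + t) / 2 * e ω ^ 2 + t * R ω) ∂μ := by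
      refine integral_mono i3.neg.norm j3 fun ω => ?_
      simp only [norm_neg, Real.norm_eq_abs]
      have hr := mul_nonneg ht (hR0 ω)
      have q1 := mul_nonneg ht (sq_nonneg (X ω - e ω))
      have q2 := mul_nonneg ht (sq_nonneg (X ω + e ω))
      rw [abs_le]
      constructor <;>
      nlinarith [sq_nonneg (X ω - Y ω), sq_nonneg (X ω + Y ω), sq_nonneg (Y ω - e ω),
        sq_nonneg (Y ω + e ω)]
    refine hle.trans ?_
    rw [integral_add j2 (hRi.const_mul _), integral_add j1 (ie2.const_mul _),
      integral_add (hX2.const_mul _) iY2, integral_const_mul, integral_const_mul,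
      integral_const_mul, hRint, vY2]
    have : ∫ ω, e ω ^ 2 ∂μ ≤ ∫ ω, X ω ^ 2 ∂μ := by linarith
    nlinarith

/-- Integrated I-MMSE relation. -/
lemma immse (hX : Measurable X) (hN : Measurable N) (hXN : IndepFun X N μ)
    (hN_law : μ.map N = gaussianReal 0 1) (hX2 : Integrable (fun ω => X ω ^ 2) μ) (T : ℝ)
    (hT : 0 ≤ T) :
    Integrable (fun ω => Real.log (num (μ.map X) (fun _ => 1) T (T * X ω + N ω))
      - Real.log (stdPhi (N ω))) μ ∧
    IntegrableOn (fun t => t * mm μ X N t) (Set.Ioc 0 T) volume ∧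
    ∫ ω, (Real.log (num (μ.map X) (fun _ => 1) T (T * X ω + N ω)) - Real.log (stdPhi (N ω))) ∂μ
      = - ∫ t in Set.Ioc 0 T, t * mm μ X N t := by
  have : IsProbabilityMeasure (μ.map X) := Measure.isProbabilityMeasure_map hX.aemeasurable
  set P := μ.map X with hPdef
  have hXL := memLp_X hX hX2
  have hXi : Integrable X μ := hXL.integrable (by norm_num)
  have hPi : Integrable (fun x => x) P :=
    (integrable_map_measure (by fun_prop) hX.aemeasurable).2 hXi
  have hmeas : Measurable (fun z : ℝ × Ω => lder P z.1 (X z.2) (N z.2)) :=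
    measurable_lder.comp (by fun_prop : Measurable fun z : ℝ × Ω => (z.1, X z.2, N z.2))
  have hInt0 : Integrable (fun z : ℝ × Ω => lder P z.1 (X z.2) (N z.2))
      ((volume.restrict (Set.Ioc 0 T)).prod μ) := by
    rw [integrable_prod_iff hmeas.aestronglyMeasurable]
    constructor
    · filter_upwards [ae_restrict_mem measurableSet_Ioc] with t ht
      exact (lder_facts hX hN hXN hN_law hX2 t ht.1.le).1
    · have hb : ∀ᵐ t ∂(volume.restrict (Set.Ioc 0 T)),
          ‖∫ ω, ‖lder P t (X ω) (N ω)‖ ∂μ‖ ≤ (T ^ 2 + 2 * T + 1) * ∫ ω, X ω ^ 2 ∂μ + 1 := by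
        filter_upwards [ae_restrict_mem measurableSet_Ioc] with t ht
        rw [Real.norm_of_nonneg (integral_nonneg fun ω => norm_nonneg _)]
        refine (lder_facts hX hN hXN hN_law hX2 t ht.1.le).2.2.trans ?_
        have h1 : 0 ≤ ∫ ω, X ω ^ 2 ∂μ := integral_nonneg fun ω => sq_nonneg _
        have h2 := ht.1.le
        have h3 := ht.2
        gcongr
      refine Integrable.of_bound ?_ _ hb
      exact (hmeas.norm.stronglyMeasurable.integral_prod_right' (ν := μ)).aestronglyMeasurable
  have hftc : ∀ ω, ∫ t in Set.Ioc 0 T, lder P t (X ω) (N ω) =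
      Real.log (num P (fun _ => 1) T (T * X ω + N ω)) - Real.log (stdPhi (N ω)) := fun ω => by
    rw [← ftc_lder hPi, intervalIntegral.integral_of_le hT]
  have hmmE : ∀ t ∈ Set.Ioc 0 T, ∫ ω, lder P t (X ω) (N ω) ∂μ = -(t * mm μ X N t) := fun t ht =>
    (lder_facts hX hN hXN hN_law hX2 t ht.1.le).2.1
  refine ⟨?_, ?_, ?_⟩
  · simp_rw [← hftc]
    exact hInt0.integral_prod_right
  · have h1 : Integrable (fun t => ∫ ω, lder P t (X ω) (N ω) ∂μ) (volume.restrict (Set.Ioc 0 T)) :=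
      hInt0.integral_prod_left
    have h2 : IntegrableOn (fun t => -(t * mm μ X N t)) (Set.Ioc 0 T) volume :=
      (integrableOn_congr_fun hmmE measurableSet_Ioc).1 h1
    simpa using h2.neg
  · simp_rw [← hftc]
    rw [← integral_neg, ← setIntegral_congr_fun measurableSet_Ioc hmmE]
    exact (integral_integral_swap (μ := volume.restrict (Set.Ioc 0 T)) (ν := μ)
      (f := fun t ω => lder P t (X ω) (N ω)) hInt0).symm

lemma klDiv_bridge {α : Type*} [MeasurableSpace α] (P Q : Measure α) [IsProbabilityMeasure P]
    [IsProbabilityMeasure Q] : klDiv P Q = InformationTheory.klDiv P Q := by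
  unfold klDiv
  split_ifs with h
  · rw [InformationTheory.klDiv_of_ac_of_integrable h.1 h.2]
    simp
  · rw [eq_comm, InformationTheory.klDiv_eq_top_iff]
    intro h1 h2
    exact h ⟨h1, h2⟩

lemma dv_pointwise {r : ℝ} (hr : 0 ≤ r) (f : ℝ) :
    r * f - (rexp f - 1) ≤ InformationTheory.klFun r := by
  rw [InformationTheory.klFun_apply]
  rcases hr.eq_or_lt with rfl | hr
  · have := Real.exp_pos f
    simp; linarith
  · have h1 := Real.add_one_le_exp (f - Real.log r)
    rw [Real.exp_sub, Real.exp_log hr, le_div_iff₀ hr] at h1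
    linarith

lemma dv_ineq {α : Type*} [MeasurableSpace α] {P Q : Measure α} [IsProbabilityMeasure P]
    [IsProbabilityMeasure Q] {f : α → ℝ} (hf : Measurable f) {M : ℝ} (hM : ∀ x, |f x| ≤ M) :
    ENNReal.ofReal (∫ x, f x ∂P - ∫ x, (rexp (f x) - 1) ∂Q) ≤ InformationTheory.klDiv P Q := by
  by_cases h : InformationTheory.klDiv P Q = ⊤
  · rw [h]; exact le_top
  obtain ⟨h1, h2⟩ := InformationTheory.klDiv_ne_top_iff.1 h
  rw [ENNReal.ofReal_le_iff_le_toReal h, InformationTheory.toReal_klDiv_eq_integral_klFun h1,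
    ← integral_rnDeriv_smul h1]
  have i1 : Integrable (fun x => (P.rnDeriv Q x).toReal • f x) Q := by
    rw [integrable_rnDeriv_smul_iff h1]
    exact Integrable.of_bound hf.aestronglyMeasurable M (ae_of_all _ hM)
  have i2 : Integrable (fun x => rexp (f x) - 1) Q := by
    refine Integrable.sub (Integrable.of_bound (by fun_prop) (rexp M) (ae_of_all _ fun x => ?_))
      (integrable_const 1)
    rw [Real.norm_of_nonneg (Real.exp_pos _).le]
    exact Real.exp_le_exp.2 ((le_abs_self _).trans (hM x))
  rw [← integral_sub i1 i2]
  refine integral_mono (i1.sub i2) ((InformationTheory.integrable_klFun_rnDeriv_iff h1).2 h2)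
    fun x => ?_
  exact dv_pointwise ENNReal.toReal_nonneg (f x)

lemma exp_sub_le {M a b : ℝ} (ha : |a| ≤ M) (hb : |b| ≤ M) :
    |rexp a - rexp b| ≤ rexp M * |a - b| := by
  have key : ∀ a b : ℝ, |a| ≤ M → rexp a - rexp b ≤ rexp M * |a - b| := by
    intro a b ha
    have h1 := Real.add_one_le_exp (b - a)
    have h2 : rexp b = rexp a * rexp (b - a) := by rw [← Real.exp_add]; congr 1; ring
    have h3 : rexp a ≤ rexp M := Real.exp_le_exp.2 ((le_abs_self _).trans ha)
    have h4 := le_abs_self (a - b)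
    have h5 := Real.exp_pos a
    calc rexp a - rexp b ≤ rexp a * (a - b) := by rw [h2]; nlinarith
      _ ≤ rexp a * |a - b| := by gcongr
      _ ≤ _ := by gcongr
  rw [abs_le]
  constructor
  · have := key b a hb
    rw [abs_sub_comm] at this
    linarith
  · exact key a b ha

lemma clip_abs {M x : ℝ} (hM : 0 ≤ M) : |max (-M) (min x M)| ≤ M := by
  rw [abs_le]
  exact ⟨le_max_left _ _, max_le (by linarith) (min_le_right _ _)⟩

lemma clip_dist {M a x : ℝ} (ha : |a| ≤ M) : |a - max (-M) (min x M)| ≤ |a - x| := by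
  obtain ⟨h1, h2⟩ := abs_le.1 ha
  rcases le_total x M with h | h <;> rcases le_total (-M) x with h' | h'
  · simp [h, h']
  · rw [min_eq_left h, max_eq_left h', abs_of_nonneg (by linarith), abs_of_nonneg (by linarith)]
    linarith
  · rw [min_eq_right h, max_eq_right (by linarith), abs_of_nonpos (by linarith),
      abs_of_nonpos (by linarith)]
    linarith
  · rw [min_eq_right h, max_eq_right (by linarith), abs_of_nonpos (by linarith),
      abs_of_nonpos (by linarith)]
    linarith

/-- extension from continuous to measurable test functions. -/
lemma dv_extend {P Q : Measure ℝ} [IsProbabilityMeasure P] [IsProbabilityMeasure Q] {l : ℝ}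
    (H : ∀ f : ℝ → ℝ, Continuous f → (∃ M, ∀ x, |f x| ≤ M) →
      ∫ x, f x ∂P - ∫ x, (rexp (f x) - 1) ∂Q ≤ l)
    {f : ℝ → ℝ} (hf : Measurable f) {M : ℝ} (hM : ∀ x, |f x| ≤ M) :
    ∫ x, f x ∂P - ∫ x, (rexp (f x) - 1) ∂Q ≤ l := by
  have hM0 : 0 ≤ M := (abs_nonneg _).trans (hM 0)
  apply le_of_forall_pos_le_add
  intro ε hε
  set C := 1 + rexp M with hC
  have hC0 : 0 < C := by positivity
  have hfL : MemLp f 1 (P + Q) :=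
    MemLp.of_bound hf.aestronglyMeasurable M (ae_of_all _ hM)
  obtain ⟨g, hg, hgL⟩ := hfL.exists_boundedContinuous_eLpNorm_sub_le (by simp)
    (ε := ENNReal.ofReal (ε / C)) (by simp; positivity)
  have hI : Integrable (fun x => |f x - g x|) (P + Q) :=
    (memLp_one_iff_integrable.1 (hfL.sub hgL)).abs
  have hIle : ∫ x, |f x - g x| ∂(P + Q) ≤ ε / C := by
    rw [eLpNorm_one_eq_lintegral_enorm] at hg
    have : ∫ x, |f x - g x| ∂(P + Q) = (∫⁻ x, ‖(f - g) x‖ₑ ∂(P + Q)).toReal := by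
      rw [← integral_norm_eq_lintegral_enorm]
      · rfl
      · exact (hf.sub g.continuous.measurable).aestronglyMeasurable
    rw [this]
    exact ENNReal.toReal_le_of_le_ofReal (by positivity) hg
  obtain ⟨hIP, hIQ⟩ := integrable_add_measure.1 hI
  rw [integral_add_measure hIP hIQ] at hIle
  set g' : ℝ → ℝ := fun x => max (-M) (min (g x) M) with hg'
  have hgc := g.continuous
  have hg'c : Continuous g' := by fun_prop
  have hg'm := hg'c.measurable
  have hg'M : ∀ x, |g' x| ≤ M := fun x => clip_abs hM0
  have hd : ∀ x, |f x - g' x| ≤ |f x - g x| := fun x => clip_dist (hM x)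
  have h0 := H g' hg'c ⟨M, hg'M⟩
  have expb : ∀ (u : ℝ → ℝ), Measurable u → (∀ x, |u x| ≤ M) →
      Integrable (fun x => rexp (u x) - 1) Q := by
    intro u hu huM
    refine Integrable.sub (Integrable.of_bound (by fun_prop) (rexp M) (ae_of_all _ fun x => ?_))
      (integrable_const 1)
    rw [Real.norm_of_nonneg (Real.exp_pos _).le]
    exact Real.exp_le_exp.2 ((le_abs_self _).trans (huM x))
  have ifP : Integrable f P := Integrable.of_bound hf.aestronglyMeasurable M (ae_of_all _ hM)
  have igP : Integrable g' P := Integrable.of_bound hg'm.aestronglyMeasurable M (ae_of_all _ hg'M)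
  have a1 : ∫ x, f x ∂P - ∫ x, g' x ∂P ≤ ∫ x, |f x - g x| ∂P := by
    rw [← integral_sub ifP igP]
    exact integral_mono (ifP.sub igP) hIP fun x => (le_abs_self _).trans (hd x)
  have a2 : ∫ x, (rexp (g' x) - 1) ∂Q - ∫ x, (rexp (f x) - 1) ∂Q
      ≤ rexp M * ∫ x, |f x - g x| ∂Q := by
    rw [← integral_sub (expb g' hg'm hg'M) (expb f hf hM), ← integral_const_mul]
    refine integral_mono ((expb g' hg'm hg'M).sub (expb f hf hM)) (hIQ.const_mul _) fun x => ?_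
    have h1 := exp_sub_le (hg'M x) (hM x)
    rw [abs_sub_comm (g' x)] at h1
    have h2 := le_abs_self (rexp (g' x) - rexp (f x))
    have h3 := mul_le_mul_of_nonneg_left (hd x) (Real.exp_pos M).le
    simp only
    linarith
  have b1 : 0 ≤ ∫ x, |f x - g x| ∂P := integral_nonneg fun x => abs_nonneg _
  have b2 : 0 ≤ ∫ x, |f x - g x| ∂Q := integral_nonneg fun x => abs_nonneg _
  have b3 : C * (∫ x, |f x - g x| ∂P + ∫ x, |f x - g x| ∂Q) ≤ ε := by
    calc _ ≤ C * (ε / C) := by gcongr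
      _ = ε := by field_simp
  have b4 := (Real.exp_pos M).le
  have b5 : 0 ≤ rexp M * ∫ x, |f x - g x| ∂P := mul_nonneg b4 b1
  rw [hC] at b3
  nlinarith

lemma ac_of_dv {P Q : Measure ℝ} [IsProbabilityMeasure P] [IsProbabilityMeasure Q] {l : ℝ}
    (H : ∀ f : ℝ → ℝ, Measurable f → (∃ M, ∀ x, |f x| ≤ M) →
      ∫ x, f x ∂P - ∫ x, (rexp (f x) - 1) ∂Q ≤ l) : P ≪ Q := by
  refine Measure.AbsolutelyContinuous.mk fun A hA hQA => ?_
  have key : ∀ k : ℕ, k * P.real A ≤ l := by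
    intro k
    have h := H (A.indicator fun _ => (k : ℝ)) (measurable_const.indicator hA)
      ⟨k, fun x => by by_cases hx : x ∈ A <;> simp [hx]⟩
    rw [integral_indicator_const _ hA] at h
    have h0 : ∫ x, (rexp (A.indicator (fun _ => (k : ℝ)) x) - 1) ∂Q = 0 := by
      have : (fun x => rexp (A.indicator (fun _ => (k : ℝ)) x) - 1) =ᵐ[Q] fun _ => 0 := by
        have hn : ∀ᵐ x ∂Q, x ∉ A := measure_eq_zero_iff_ae_notMem.1 hQA
        filter_upwards [hn] with x hx
        simp [hx]
      rw [integral_congr_ae this]; simp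
    rw [h0] at h
    simp only [smul_eq_mul] at h
    linarith
  by_contra hne
  have hpos : 0 < P.real A := ENNReal.toReal_pos hne (measure_ne_top _ _)
  obtain ⟨k, hk⟩ := exists_nat_gt (l / P.real A)
  rw [div_lt_iff₀ hpos] at hk
  linarith [key k]

lemma klDiv_le_of_dv {P Q : Measure ℝ} [IsProbabilityMeasure P] [IsProbabilityMeasure Q] {l : ℝ}
    (H : ∀ f : ℝ → ℝ, Continuous f → (∃ M, ∀ x, |f x| ≤ M) →
      ∫ x, f x ∂P - ∫ x, (rexp (f x) - 1) ∂Q ≤ l) :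
    InformationTheory.klDiv P Q ≤ ENNReal.ofReal l := by
  have H' : ∀ f : ℝ → ℝ, Measurable f → (∃ M, ∀ x, |f x| ≤ M) →
      ∫ x, f x ∂P - ∫ x, (rexp (f x) - 1) ∂Q ≤ l := fun f hf ⟨M, hM⟩ => dv_extend H hf hM
  have hac := ac_of_dv H'
  rw [InformationTheory.klDiv_eq_lintegral_klFun_of_ac hac]
  set r : ℝ → ℝ := fun x => (P.rnDeriv Q x).toReal with hr
  have hrm : Measurable r := by fun_prop
  have hr0 : ∀ x, 0 ≤ r x := fun x => ENNReal.toReal_nonneg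
  set c : ℕ → ℝ → ℝ := fun k x => max (rexp (-k)) (min (r x) (rexp k)) with hc
  have hcm : ∀ k, Measurable (c k) := fun k => by fun_prop
  have hcpos : ∀ k x, 0 < c k x := fun k x => lt_max_of_lt_left (Real.exp_pos _)
  have hclow : ∀ (k : ℕ) x, rexp (-k) ≤ c k x := fun k x => le_max_left _ _
  have hk1 : ∀ k : ℕ, rexp (-k) ≤ 1 := fun k => Real.exp_le_one_iff.2 (by simp)
  have hk2 : ∀ k : ℕ, 1 ≤ rexp k := fun k => Real.one_le_exp (by simp)
  have hcup : ∀ (k : ℕ) x, c k x ≤ rexp k := fun k x =>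
    max_le ((hk1 k).trans (hk2 k)) (min_le_right _ _)
  set h : ℕ → ℝ → ℝ := fun k x => r x * Real.log (c k x) - (c k x - 1) with hh
  have hhm : ∀ k, Measurable (h k) := fun k => by
    have := hcm k
    fun_prop
  have hlogb : ∀ (k : ℕ) x, |Real.log (c k x)| ≤ k := fun k x => by
    rw [abs_le]
    constructor
    · rw [Real.le_log_iff_exp_le (hcpos k x)]; exact hclow k x
    · rw [Real.log_le_iff_le_exp (hcpos k x)]; exact hcup k x
  have hnn : ∀ k x, 0 ≤ h k x := fun k x => by
    have h1 := InformationTheory.klFun_nonneg (hcpos k x).le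
    rw [InformationTheory.klFun_apply] at h1
    have h2 : 0 ≤ (r x - c k x) * Real.log (c k x) := by
      rcases le_total (r x) (rexp (-k)) with hx | hx
      · have e : c k x = rexp (-k) := by
          simp only [hc]
          exact max_eq_left ((min_le_left _ _).trans hx)
        rw [e]
        refine mul_nonneg_of_nonpos_of_nonpos (by linarith) ?_
        rw [Real.log_exp]; simp
      · rcases le_total (r x) (rexp k) with hx2 | hx2
        · have e : c k x = r x := by simp only [hc]; rw [min_eq_left hx2, max_eq_right hx]
          rw [e]; simp
        · have e : c k x = rexp k := by
            simp only [hc]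
            rw [min_eq_right hx2, max_eq_right ((hk1 k).trans (hk2 k))]
          rw [e]
          refine mul_nonneg (by linarith) ?_
          rw [Real.log_exp]; simp
    simp only [hh]
    nlinarith
  have hlim : ∀ x, Tendsto (fun k => h k x) atTop (𝓝 (InformationTheory.klFun (r x))) := fun x => by
    have hcl : Tendsto (fun k => c k x) atTop (𝓝 (r x)) := by
      have e1 : Tendsto (fun k : ℕ => rexp (-(k : ℝ))) atTop (𝓝 0) :=
        Real.tendsto_exp_neg_atTop_nhds_zero.comp tendsto_natCast_atTop_atTop
      have e2 : Tendsto (fun k : ℕ => min (r x) (rexp (k : ℝ))) atTop (𝓝 (r x)) := by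
        have : Tendsto (fun k : ℕ => rexp (k : ℝ)) atTop atTop :=
          Real.tendsto_exp_atTop.comp tendsto_natCast_atTop_atTop
        refine tendsto_const_nhds.congr' ?_
        filter_upwards [this.eventually_ge_atTop (r x)] with k hk
        rw [min_eq_left hk]
      have := e1.max e2
      rwa [max_eq_right (hr0 x)] at this
    have e : InformationTheory.klFun (r x) = r x * Real.log (r x) - (r x - 1) := by
      rw [InformationTheory.klFun_apply]; ring
    rw [e]
    refine Tendsto.sub ?_ (hcl.sub_const 1)
    rcases (hr0 x).eq_or_lt with h0 | h0
    · rw [← h0]; simp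
    · exact (hcl.log h0.ne').const_mul _
  have hbound : ∀ k, ∫⁻ x, ENNReal.ofReal (h k x) ∂Q ≤ ENNReal.ofReal l := fun k => by
    have hlm : Measurable (fun x => Real.log (c k x)) := (hcm k).log
    have i1 : Integrable (fun x => (P.rnDeriv Q x).toReal • Real.log (c k x)) Q := by
      rw [integrable_rnDeriv_smul_iff hac]
      exact Integrable.of_bound hlm.aestronglyMeasurable k (ae_of_all _ (hlogb k))
    have i2 : Integrable (fun x => c k x - 1) Q := by
      refine Integrable.sub (Integrable.of_bound (hcm k).aestronglyMeasurable (rexp k)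
        (ae_of_all _ fun x => ?_)) (integrable_const 1)
      rw [Real.norm_of_nonneg (hcpos k x).le]
      exact hcup k x
    have i3 : Integrable (h k) Q := i1.sub i2
    rw [← ofReal_integral_eq_lintegral_ofReal i3 (ae_of_all _ (hnn k))]
    apply ENNReal.ofReal_le_ofReal
    have := H' (fun x => Real.log (c k x)) hlm ⟨k, hlogb k⟩
    simp only [Real.exp_log (hcpos k _)] at this
    rw [← integral_rnDeriv_smul hac, ← integral_sub i1 i2] at this
    exact this
  calc ∫⁻ x, ENNReal.ofReal (InformationTheory.klFun (r x)) ∂Q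
      = ∫⁻ x, liminf (fun k => ENNReal.ofReal (h k x)) atTop ∂Q := by
        refine lintegral_congr fun x => ?_
        exact ((ENNReal.continuous_ofReal.tendsto _).comp (hlim x)).liminf_eq.symm
    _ ≤ liminf (fun k => ∫⁻ x, ENNReal.ofReal (h k x) ∂Q) atTop :=
        lintegral_liminf_le fun k => (hhm k).ennreal_ofReal
    _ ≤ ENNReal.ofReal l := by
        refine (liminf_le_liminf (Eventually.of_forall hbound)).trans ?_
        simp

/-- Gaussian channel acting on a law. -/
def chan (Q : Measure ℝ) (T : ℝ) : Measure ℝ :=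
  (Q.prod (gaussianReal 0 1)).map (fun z => T * z.1 + z.2)

instance isProb_chan (Q : Measure ℝ) [IsProbabilityMeasure Q] (T : ℝ) :
    IsProbabilityMeasure (chan Q T) :=
  Measure.isProbabilityMeasure_map (by fun_prop)

lemma chan_map (hX : Measurable X) (hN : Measurable N) (hXN : IndepFun X N μ)
    (hN_law : μ.map N = gaussianReal 0 1) (T : ℝ) :
    chan (μ.map X) T = μ.map (fun ω => T * X ω + N ω) := by
  unfold chan
  rw [← hN_law, ← (indepFun_iff_map_prod_eq_prod_map_map hX.aemeasurable hN.aemeasurable).1 hXN,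
    Measure.map_map (by fun_prop) (by fun_prop)]
  rfl

lemma chan_gaussian (m : ℝ) (v : ℝ≥0) (T : ℝ) :
    chan (gaussianReal m v) T = gaussianReal (T * m) (NNReal.mk (T ^ 2) (sq_nonneg T) * v + 1) := by
  unfold chan
  have hind : IndepFun (fun z : ℝ × ℝ => T * z.1) (fun z : ℝ × ℝ => z.2)
      ((gaussianReal m v).prod (gaussianReal 0 1)) :=
    indepFun_prod (X := fun x : ℝ => T * x) (Y := fun x : ℝ => x) (by fun_prop) (by fun_prop)
  have h := gaussianReal_add_gaussianReal_of_indepFun hind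
    (m₁ := T * m) (v₁ := NNReal.mk (T ^ 2) (sq_nonneg T) * v) (m₂ := 0) (v₂ := 1) ?_ ?_
  · rw [add_zero] at h
    exact h
  · have : (fun z : ℝ × ℝ => T * z.1) = (fun x => T * x) ∘ Prod.fst := rfl
    rw [this, ← Measure.map_map (by fun_prop) (by fun_prop), Measure.map_fst_prod]
    simp only [measure_univ, one_smul]
    exact gaussianReal_map_const_mul T
  · have := Measure.map_snd_prod (μ := gaussianReal m v) (ν := gaussianReal 0 1)
    simpa using this

lemma klDiv_chan_le (P Q : Measure ℝ) [IsProbabilityMeasure P] [IsProbabilityMeasure Q] (T : ℝ) :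
    InformationTheory.klDiv (chan P T) (chan Q T) ≤ InformationTheory.klDiv P Q := by
  refine (InformationTheory.klDiv_map_le _ _ (by fun_prop)).trans ?_
  have := InformationTheory.klDiv_compProd_left P Q (Kernel.const ℝ (gaussianReal 0 1))
  rw [Measure.compProd_const, Measure.compProd_const] at this
  exact this.le

lemma tendsto_chan (Q : Measure ℝ) [IsProbabilityMeasure Q] {f : ℝ → ℝ} (hf : Continuous f)
    {M : ℝ} (hM : ∀ x, |f x| ≤ M) :
    Tendsto (fun k : ℕ => ∫ y, f (y / ((k : ℝ) + 1)) ∂(chan Q ((k : ℝ) + 1))) atTop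
      (𝓝 (∫ x, f x ∂Q)) := by
  have hfm := hf.measurable
  have e : ∀ k : ℕ, ∫ y, f (y / ((k : ℝ) + 1)) ∂(chan Q ((k : ℝ) + 1)) =
      ∫ z, f (z.1 + z.2 * (1 / ((k : ℝ) + 1))) ∂(Q.prod (gaussianReal 0 1)) := fun k => by
    unfold chan
    rw [integral_map (by fun_prop)
      (by fun_prop : Measurable fun y => f (y / ((k : ℝ) + 1))).aestronglyMeasurable]
    refine integral_congr_ae (ae_of_all _ fun z => ?_)
    have : (k : ℝ) + 1 ≠ 0 := by positivity
    simp only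
    congr 1
    field_simp
  have e2 : ∫ x, f x ∂Q = ∫ z, f z.1 ∂(Q.prod (gaussianReal 0 1)) := by
    rw [integral_fun_fst]; simp
  simp_rw [e]
  rw [e2]
  refine tendsto_integral_of_dominated_convergence (fun _ => M) ?_ (integrable_const M) ?_ ?_
  · intro k
    exact (by fun_prop : Measurable fun z : ℝ × ℝ => f (z.1 + z.2 * (1 / ((k : ℝ) + 1)))).aestronglyMeasurable
  · intro k
    exact ae_of_all _ fun z => hM _
  · refine ae_of_all _ fun z => ?_
    refine (hf.tendsto _).comp ?_
    have := (tendsto_one_div_add_atTop_nhds_zero_nat (𝕜 := ℝ)).const_mul z.2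
    simpa using this.const_add z.1

lemma klDiv_le_of_chan (P Q : Measure ℝ) [IsProbabilityMeasure P] [IsProbabilityMeasure Q]
    (L : ℝ≥0∞)
    (hL : ∀ k : ℕ, InformationTheory.klDiv (chan P ((k : ℝ) + 1)) (chan Q ((k : ℝ) + 1)) ≤ L) :
    InformationTheory.klDiv P Q ≤ L := by
  by_cases hT : L = ⊤
  · rw [hT]; exact le_top
  rw [← ENNReal.ofReal_toReal hT]
  refine klDiv_le_of_dv fun f hf ⟨M, hM⟩ => ?_
  have l1 := tendsto_chan P hf hM
  have hexp : ∀ x, |rexp (f x) - 1| ≤ rexp M + 1 := fun x => by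
    have h1 := Real.exp_pos (f x)
    have h2 : rexp (f x) ≤ rexp M := Real.exp_le_exp.2 ((le_abs_self _).trans (hM x))
    rw [abs_le]; constructor <;> linarith
  have l2 := tendsto_chan Q (f := fun x => rexp (f x) - 1) (by fun_prop) hexp
  refine le_of_tendsto (l1.sub l2) (Eventually.of_forall fun k => ?_)
  have hfm := hf.measurable
  rw [← ENNReal.ofReal_le_iff_le_toReal hT]
  exact (dv_ineq (f := fun y => f (y / ((k : ℝ) + 1))) (by fun_prop) (fun y => hM _)).trans (hL k)

lemma klDiv_out (hX : Measurable X) (hN : Measurable N) (hXN : IndepFun X N μ)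
    (hN_law : μ.map N = gaussianReal 0 1) (hX2 : Integrable (fun ω => X ω ^ 2) μ) (T : ℝ)
    (hT : 0 ≤ T) (V : ℝ≥0) (hV : (V : ℝ) = 1 + T ^ 2 * variance X μ) :
    InformationTheory.klDiv (μ.map (fun ω => T * X ω + N ω)) (gaussianReal (T * ∫ ω, X ω ∂μ) V)
      = ENNReal.ofReal (1 / 2 * Real.log (1 + T ^ 2 * variance X μ)
          - ∫ t in Set.Ioc 0 T, t * mm μ X N t) := by
  have : IsProbabilityMeasure (μ.map X) := Measure.isProbabilityMeasure_map hX.aemeasurable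
  set Y : Ω → ℝ := fun ω => T * X ω + N ω with hYdef
  have hY : Measurable Y := by fun_prop
  have : IsProbabilityMeasure (μ.map Y) := Measure.isProbabilityMeasure_map hY.aemeasurable
  have hXL := memLp_X hX hX2
  have hNL := memLp_N hN hN_law
  have hYL : MemLp Y 2 μ := memLp_Y hX hN hN_law hX2 T
  have hXi : Integrable X μ := hXL.integrable (by norm_num)
  have hNi : Integrable N μ := hNL.integrable (by norm_num)
  have hYi : Integrable Y μ := hYL.integrable (by norm_num)
  have hV0 : (0 : ℝ) < V := by
    rw [hV]; have := variance_nonneg X μ; positivity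
  have hVne : V ≠ 0 := by rintro rfl; simp at hV0
  set m := ∫ ω, X ω ∂μ with hm
  set p : ℝ → ℝ := num (μ.map X) (fun _ => 1) T with hp
  have hpm : Measurable p := measurable_num (by fun_prop) T
  have hp0 : ∀ y, 0 < p y := fun y => num_one_pos T y
  set g : ℝ → ℝ := gaussianPDFReal (T * m) V with hg
  have hgm : Measurable g := measurable_gaussianPDFReal _ _
  have hg0 : ∀ y, 0 < g y := fun y => gaussianPDFReal_pos _ _ _ hVne
  -- the density
  have hdens : μ.map Y = (gaussianReal (T * m) V).withDensity
      (fun y => ENNReal.ofReal (p y / g y)) := by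
    rw [map_out hX hN hXN hN_law T, gaussianReal_of_var_ne_zero _ hVne,
      ← withDensity_mul _ (by fun_prop) (by fun_prop)]
    congr 1
    ext y
    simp only [Pi.mul_apply, gaussianPDF]
    rw [← ENNReal.ofReal_mul (hg0 y).le, mul_div_cancel₀ _ (hg0 y).ne']
  have hac : μ.map Y ≪ gaussianReal (T * m) V := by
    rw [hdens]; exact withDensity_absolutelyContinuous _ _
  have hllr : llr (μ.map Y) (gaussianReal (T * m) V) =ᵐ[μ.map Y]
      fun y => Real.log (p y) - Real.log (g y) := by
    have h1 : (μ.map Y).rnDeriv (gaussianReal (T * m) V) =ᵐ[gaussianReal (T * m) V]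
        (fun y => ENNReal.ofReal (p y / g y)) := by
      rw [hdens]; exact Measure.rnDeriv_withDensity _ (by fun_prop)
    filter_upwards [hac.ae_le h1] with y hy
    rw [llr, hy, ENNReal.toReal_ofReal (div_nonneg (hp0 y).le (hg0 y).le),
      Real.log_div (hp0 y).ne' (hg0 y).ne']
  obtain ⟨im1, im2, im3⟩ := immse hX hN hXN hN_law hX2 T hT
  have hlogg : ∀ y, Real.log (g y) = Real.log ((√(2 * π * V))⁻¹) - (y - T * m) ^ 2 / (2 * V) := by
    intro y
    simp only [hg, gaussianPDFReal]
    rw [Real.log_mul (by positivity) (by positivity), Real.log_exp]; ring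
  have iN2 : Integrable (fun ω => N ω ^ 2 / 2) μ := hNL.integrable_sq.div_const 2
  have iN3 : Integrable (fun ω => Real.log (stdPhi (N ω))) μ := by
    simp_rw [log_stdPhi]
    exact (integrable_const _).sub iN2
  have iY2 : Integrable (fun ω => (Y ω - T * m) ^ 2 / (2 * V)) μ :=
    ((hYL.sub (memLp_const (T * m))).integrable_sq).div_const _
  have iY3 : Integrable (fun ω => Real.log (g (Y ω))) μ := by
    simp_rw [hlogg]
    exact (integrable_const _).sub iY2
  have vN : ∫ ω, Real.log (stdPhi (N ω)) ∂μ = Real.log ((√(2 * π))⁻¹) - 1 / 2 := by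
    simp_rw [log_stdPhi]
    rw [integral_sub (integrable_const _) iN2, integral_div, integral_N_sq hN hN_law]
    simp
  have vYsq : ∫ ω, (Y ω - T * m) ^ 2 ∂μ = V := by
    have e : ∀ ω, (Y ω - T * m) ^ 2 = Y ω ^ 2 - 2 * (T * m) * Y ω + (T * m) ^ 2 := fun ω => by ring
    simp_rw [e]
    have i1 : Integrable (fun ω => Y ω ^ 2 - 2 * (T * m) * Y ω) μ :=
      hYL.integrable_sq.sub (hYi.const_mul _)
    have vY : ∫ ω, Y ω ∂μ = T * m := by
      simp only [hYdef]
      rw [integral_add (hXi.const_mul T) hNi, integral_const_mul, integral_N hN hN_law, add_zero]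
    rw [integral_add i1 (integrable_const _), integral_sub hYL.integrable_sq (hYi.const_mul _),
      integral_const_mul, vY, integral_Y_sq hX hN hXN hN_law hX2 T, hV, variance_eq_sub hXL]
    simp only [integral_const, probReal_univ, one_smul, Pi.pow_apply, ← hm]
    ring
  have vY : ∫ ω, Real.log (g (Y ω)) ∂μ = Real.log ((√(2 * π * V))⁻¹) - 1 / 2 := by
    simp_rw [hlogg]
    rw [integral_sub (integrable_const _) iY2, integral_div, vYsq]
    simp
    field_simp
  have iall : Integrable (fun ω => Real.log (p (Y ω)) - Real.log (g (Y ω))) μ := by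
    have := (im1.add iN3).sub iY3
    refine this.congr (ae_of_all _ fun ω => ?_)
    simp [hp, hYdef]
  have vall : ∫ ω, (Real.log (p (Y ω)) - Real.log (g (Y ω))) ∂μ =
      1 / 2 * Real.log (1 + T ^ 2 * variance X μ) - ∫ t in Set.Ioc 0 T, t * mm μ X N t := by
    have e : ∀ ω, Real.log (p (Y ω)) - Real.log (g (Y ω)) =
      (Real.log (p (Y ω)) - Real.log (stdPhi (N ω))) + Real.log (stdPhi (N ω))
        - Real.log (g (Y ω)) := fun ω => by ring
    simp_rw [e]
    have j1 : Integrable (fun ω => (Real.log (p (Y ω)) - Real.log (stdPhi (N ω)))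
      + Real.log (stdPhi (N ω))) μ := im1.add iN3
    rw [integral_sub j1 iY3, integral_add im1 iN3, im3, vN, vY, ← hV]
    have h1 : Real.log ((√(2 * π * V))⁻¹) = Real.log ((√(2 * π))⁻¹) - 1 / 2 * Real.log V := by
      rw [Real.log_inv, Real.log_inv, Real.log_sqrt (by positivity), Real.log_sqrt (by positivity),
        Real.log_mul (by positivity) (by positivity)]
      ring
    rw [h1]; ring
  have hmeas : Measurable (fun y => Real.log (p y) - Real.log (g y)) := by fun_prop
  have illr : Integrable (llr (μ.map Y) (gaussianReal (T * m) V)) (μ.map Y) := by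
    rw [integrable_congr hllr, integrable_map_measure hmeas.aestronglyMeasurable hY.aemeasurable]
    exact iall
  rw [InformationTheory.klDiv_of_ac_of_integrable hac illr, integral_congr_ae hllr,
    integral_map hY.aemeasurable hmeas.aestronglyMeasurable, vall]
  simp

lemma mm_le (hX : Measurable X) (hN : Measurable N) (hXN : IndepFun X N μ)
    (hN_law : μ.map N = gaussianReal 0 1) (hX2 : Integrable (fun ω => X ω ^ 2) μ) (t : ℝ) :
    mm μ X N t ≤ variance X μ / (1 + t ^ 2 * variance X μ) := by
  set Y : Ω → ℝ := fun ω => t * X ω + N ω with hYdef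
  have hY : Measurable Y := by fun_prop
  have hXL := memLp_X hX hX2
  have hNL := memLp_N hN hN_law
  have hYL : MemLp Y 2 μ := memLp_Y hX hN hN_law hX2 t
  set m := ∫ ω, X ω ∂μ with hm
  set v := variance X μ with hv
  have hv0 : 0 ≤ v := variance_nonneg X μ
  have hD : 0 < 1 + t ^ 2 * v := by positivity
  set a := t * v / (1 + t ^ 2 * v) with ha
  have hZL : MemLp (fun ω => m + a * (Y ω - t * m)) 2 μ :=
    (memLp_const m).add ((hYL.sub (memLp_const (t * m))).const_mul a)
  have hZm : Measurable[MeasurableSpace.comap Y inferInstance] (fun ω => m + a * (Y ω - t * m)) :=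
    (by fun_prop : Measurable fun y : ℝ => m + a * (y - t * m)).comp (comap_measurable Y)
  refine (mmse_le_general hY.comap_le hXL hZL hZm.stronglyMeasurable).trans (le_of_eq ?_)
  have hXc : MemLp (fun ω => X ω - m) 2 μ := hXL.sub (memLp_const m)
  have e : ∀ ω, (X ω - (m + a * (Y ω - t * m))) ^ 2 =
      (1 - a * t) ^ 2 * (X ω - m) ^ 2 + (- 2 * a * (1 - a * t)) * ((X ω - m) * N ω)
        + a ^ 2 * N ω ^ 2 := fun ω => by simp only [hYdef]; ring
  simp_rw [e]
  have i1 : Integrable (fun ω => (1 - a * t) ^ 2 * (X ω - m) ^ 2) μ := hXc.integrable_sq.const_mul _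
  have i2 : Integrable (fun ω => (- 2 * a * (1 - a * t)) * ((X ω - m) * N ω)) μ :=
    (hXc.integrable_mul hNL).const_mul _
  have i3 : Integrable (fun ω => (1 - a * t) ^ 2 * (X ω - m) ^ 2 +
    (- 2 * a * (1 - a * t)) * ((X ω - m) * N ω)) μ := i1.add i2
  have v1 : ∫ ω, (X ω - m) ^ 2 ∂μ = v := by
    rw [hv, variance_eq_integral hX.aemeasurable]
  have v2 : ∫ ω, (X ω - m) * N ω ∂μ = 0 := by
    have hind : IndepFun (fun ω => X ω - m) N μ :=
      hXN.comp (φ := fun x => x - m) (ψ := id) (by fun_prop) measurable_id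
    exact integral_XN (hX.sub_const m) hN hind hN_law
  rw [integral_add i3 (hNL.integrable_sq.const_mul _), integral_add i1 i2, integral_const_mul,
    integral_const_mul, integral_const_mul, v1, v2, integral_N_sq hN hN_law, ha]
  field_simp
  ring

lemma integral_log_part {v T : ℝ} (hv : 0 ≤ v) (hT : 0 ≤ T) :
    IntegrableOn (fun t => t * (v / (1 + t ^ 2 * v))) (Set.Ioc 0 T) volume ∧
    ∫ t in Set.Ioc 0 T, t * (v / (1 + t ^ 2 * v)) = 1 / 2 * Real.log (1 + T ^ 2 * v) := by
  have hD : ∀ t : ℝ, 0 < 1 + t ^ 2 * v := fun t => by positivity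
  have hc : Continuous (fun t => t * (v / (1 + t ^ 2 * v))) := by
    refine continuous_id.mul (continuous_const.div (by fun_prop) fun t => (hD t).ne')
  have hd : ∀ t : ℝ, HasDerivAt (fun t => 1 / 2 * Real.log (1 + t ^ 2 * v))
      (t * (v / (1 + t ^ 2 * v))) t := fun t => by
    have h0 : HasDerivAt (fun x : ℝ => x ^ 2) (2 * t) t := by simpa using hasDerivAt_pow 2 t
    have h1 := ((h0.mul_const v).const_add 1).log (hD t).ne'
    refine (h1.const_mul (1 / 2)).congr_deriv ?_
    have := hD t
    field_simp
  constructor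
  · exact (hc.integrableOn_Icc).mono_set Set.Ioc_subset_Icc_self
  · rw [← intervalIntegral.integral_of_le hT,
      intervalIntegral.integral_eq_sub_of_hasDerivAt (fun t _ => hd t) (hc.intervalIntegrable _ _)]
    simp

lemma klDiv_out' (hX : Measurable X) (hN : Measurable N) (hXN : IndepFun X N μ)
    (hN_law : μ.map N = gaussianReal 0 1) (hX2 : Integrable (fun ω => X ω ^ 2) μ) (T : ℝ)
    (hT : 0 ≤ T) :
    InformationTheory.klDiv (chan (μ.map X) T)
        (chan (gaussianReal (∫ ω, X ω ∂μ) (variance X μ).toNNReal) T)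
      = ∫⁻ t in Set.Ioc 0 T,
          ENNReal.ofReal (t * (variance X μ / (1 + t ^ 2 * variance X μ) - mm μ X N t)) := by
  have hv0 := variance_nonneg X μ
  rw [chan_map hX hN hXN hN_law, chan_gaussian, klDiv_out hX hN hXN hN_law hX2 T hT]
  · obtain ⟨h1, h2⟩ := integral_log_part hv0 hT
    obtain ⟨-, im2, -⟩ := immse hX hN hXN hN_law hX2 T hT
    rw [← h2, ← integral_sub h1 im2, ofReal_integral_eq_lintegral_ofReal]
    · refine lintegral_congr fun t => ?_
      rw [mul_sub]
    · exact h1.sub im2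
    · filter_upwards [ae_restrict_mem measurableSet_Ioc] with t ht
      have := mul_le_mul_of_nonneg_left (mm_le hX hN hXN hN_law hX2 t) ht.1.le
      simp only [Pi.zero_apply]
      linarith
  · rw [NNReal.coe_add, NNReal.coe_mul, Real.coe_toNNReal _ hv0, NNReal.coe_mk, NNReal.coe_one]
    ring

lemma mmse_chOut {t : ℝ} (ht : 0 ≤ t) : mmse μ X (chOut X N (t ^ 2)) = mm μ X N t := by
  have : chOut X N (t ^ 2) = fun ω => t * X ω + N ω := by
    unfold chOut
    rw [Real.sqrt_sq ht]
  rw [this]; rfl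

end helpers

/-- **Non-Gaussianness in terms of MMSE** (Theorem 15): for every `X` with finite positive
variance `σ²`, `D(P_X ‖ N(E[X], σ²)) = (1/2) ∫₀^∞ [σ²/(1 + snr·σ²) − mmse(snr)] dsnr`, where
the integrand is nonnegative for every `snr ≥ 0` and both sides may equal `+∞`. -/
theorem nonGaussianness_eq_half_integral_mmse_gap
    {Ω : Type*} [MeasurableSpace Ω] (μ : Measure Ω) [IsProbabilityMeasure μ]
    (X N : Ω → ℝ) (hX : Measurable X) (hN : Measurable N)
    (hXN : IndepFun X N μ)
    (hN_law : μ.map N = gaussianReal 0 1)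
    (hX2 : Integrable (fun ω => X ω ^ 2) μ)
    (hvar : 0 < variance X μ) :
    (∀ snr : ℝ, 0 ≤ snr →
        mmse μ X (chOut X N snr) ≤ variance X μ / (1 + snr * variance X μ)) ∧
    klDiv (μ.map X) (gaussianReal (∫ ω, X ω ∂μ) (variance X μ).toNNReal)
      = (1 / 2 : ℝ≥0∞) * ∫⁻ snr in Set.Ioi (0 : ℝ),
          ENNReal.ofReal (variance X μ / (1 + snr * variance X μ)
            - mmse μ X (chOut X N snr)) := by
  have : IsProbabilityMeasure (μ.map X) := Measure.isProbabilityMeasure_map hX.aemeasurable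
  refine ⟨fun snr hs => ?_, ?_⟩
  · have h := mm_le hX hN hXN hN_law hX2 (√snr)
    rwa [← mmse_chOut (Real.sqrt_nonneg snr), Real.sq_sqrt hs] at h
  have himg : (fun t : ℝ => t ^ 2) '' Set.Ioi 0 = Set.Ioi 0 := by
    ext s
    constructor
    · rintro ⟨t, ht, rfl⟩
      have ht' : (0 : ℝ) < t := ht
      exact pow_pos ht' 2
    · intro hs
      exact ⟨√s, Real.sqrt_pos.2 hs, Real.sq_sqrt (le_of_lt hs)⟩
  have hsub : (1 / 2 : ℝ≥0∞) * ∫⁻ snr in Set.Ioi (0 : ℝ),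
      ENNReal.ofReal (variance X μ / (1 + snr * variance X μ) - mmse μ X (chOut X N snr))
      = ∫⁻ t in Set.Ioi (0 : ℝ),
        ENNReal.ofReal (t * (variance X μ / (1 + t ^ 2 * variance X μ) - mm μ X N t)) := by
    have hcv := lintegral_image_eq_lintegral_abs_deriv_mul (s := Set.Ioi (0 : ℝ))
      (f := fun t => t ^ 2) (f' := fun t => 2 * t) measurableSet_Ioi
      (fun t _ => by simpa using (hasDerivAt_pow 2 t).hasDerivWithinAt)
      (fun a ha b hb hab => (pow_left_inj₀ (le_of_lt ha) (le_of_lt hb) two_ne_zero).1 hab)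
      (fun snr => ENNReal.ofReal (variance X μ / (1 + snr * variance X μ)
        - mmse μ X (chOut X N snr)))
    rw [himg] at hcv
    rw [hcv, ← lintegral_const_mul' _ _ (by simp)]
    refine setLIntegral_congr_fun measurableSet_Ioi fun t ht => ?_
    have ht' : (0 : ℝ) < t := ht
    have h2 : (1 / 2 : ℝ≥0∞) = ENNReal.ofReal (1 / 2) := by
      rw [ENNReal.ofReal_div_of_pos (by norm_num)]; simp
    rw [mmse_chOut ht'.le, abs_of_pos (by linarith), h2, ← mul_assoc,
      ← ENNReal.ofReal_mul (by norm_num), ← ENNReal.ofReal_mul (by linarith)]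
    congr 1
    ring
  rw [hsub, klDiv_bridge]
  apply le_antisymm
  · apply klDiv_le_of_chan
    intro k
    rw [klDiv_out' hX hN hXN hN_law hX2 _ (by positivity)]
    exact lintegral_mono_set Set.Ioc_subset_Ioi_self
  · have hU : Set.Ioi (0 : ℝ) = ⋃ k : ℕ, Set.Ioc (0 : ℝ) k := by
      ext t
      simp only [Set.mem_Ioi, Set.mem_iUnion, Set.mem_Ioc]
      constructor
      · intro ht
        obtain ⟨k, hk⟩ := exists_nat_ge t
        exact ⟨k, ht, hk⟩
      · rintro ⟨k, h, -⟩
        exact h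
    rw [hU, setLIntegral_iUnion_of_directed]
    · refine iSup_le fun k => ?_
      rw [← klDiv_out' hX hN hXN hN_law hX2 _ (by positivity)]
      exact klDiv_chan_le _ _ _
    · refine Monotone.directed_le fun a b hab => ?_
      exact Set.Ioc_subset_Ioc_right (by exact_mod_cast hab)
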